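/- Let r be a power of 2 and suppose A_n ∈ t·(ℤ/2)[t²] (n odd, positive) satisfy A_{n+8r} = t^{8r}·A_n + t^{2r}·A_{n+2r}. If for all odd n < 8r², A_n = t^n + (a sum of monomials with code strictly preceding the code of t^n), then the same holds for all odd n > 0. -/

import Mathlib

open Polynomial

/-- `(c,d)` strictly precedes `(a,b)` in the Nicolas–Serre order. -/
def prec (c d a b : ℕ) : Prop := c + d < a + b ∨ (c + d = a + b ∧ d < b)

/-- even-position bits of `x`. -/
def codeC (x : ℕ) : ℕ := if h : x = 0 then 0 else x % 2 + 2 * codeC (x / 4)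
termination_by x
decreasing_by omega

/-- odd-position bits of `x`. -/
def codeD (x : ℕ) : ℕ := codeC (x / 2)

theorem codeC_step (x : ℕ) : codeC x = x % 2 + 2 * codeC (x / 4) := by
  by_cases h : x = 0
  · subst h
    have : codeC 0 = 0 := by rw [codeC]; simp
    simp [this]
  · rw [codeC]; simp [h]

theorem codeD_step (x : ℕ) : codeD x = (x / 2) % 2 + 2 * codeD (x / 4) := by
  unfold codeD
  rw [codeC_step (x / 2)]
  congr 3
  omega

theorem codeC_zero : codeC 0 = 0 := by rw [codeC]; simp

theorem codeD_zero : codeD 0 = 0 := by simp [codeD, codeC_zero]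

theorem codeC_four (y b : ℕ) (hb : b < 4) : codeC (4 * y + b) = b % 2 + 2 * codeC y := by
  rw [codeC_step]
  have h1 : (4 * y + b) / 4 = y := by omega
  have h2 : (4 * y + b) % 2 = b % 2 := by omega
  rw [h1, h2]

theorem codeD_four (y b : ℕ) (hb : b < 4) : codeD (4 * y + b) = b / 2 + 2 * codeD y := by
  rw [codeD_step]
  have h1 : (4 * y + b) / 4 = y := by omega
  have h2 : (4 * y + b) / 2 % 2 = b / 2 := by omega
  rw [h1, h2]

/-- weak version of the order -/
def ple (c d a b : ℕ) : Prop := c + d < a + b ∨ (c + d = a + b ∧ d ≤ b)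

theorem add_one_ple (x : ℕ) : ple (codeC (x + 1)) (codeD (x + 1)) (codeC x + 1) (codeD x) := by
  induction x using Nat.strong_induction_on with
  | _ x ih =>
    obtain ⟨y, b, hb, rfl⟩ : ∃ y b, b < 4 ∧ x = 4 * y + b :=
      ⟨x / 4, x % 4, by omega, by omega⟩
    unfold ple at *
    by_cases h3 : b = 3
    · subst h3
      have e : 4 * y + 3 + 1 = 4 * (y + 1) + 0 := by ring
      have := ih y (by omega)
      rw [e, codeC_four _ _ (by omega), codeD_four _ _ (by omega), codeC_four _ _ (by omega),
        codeD_four _ _ (by omega)]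
      omega
    · rw [add_assoc, codeC_four _ _ (by omega), codeD_four _ _ (by omega), codeC_four _ _ (by omega),
        codeD_four _ _ (by omega)]
      omega

theorem add_two_ple (x : ℕ) : ple (codeC (x + 2)) (codeD (x + 2)) (codeC x) (codeD x + 1) := by
  obtain ⟨y, b, hb, rfl⟩ : ∃ y b, b < 4 ∧ x = 4 * y + b :=
    ⟨x / 4, x % 4, by omega, by omega⟩
  have := add_one_ple y
  unfold ple at *
  by_cases h3 : 2 ≤ b
  · have e : 4 * y + b + 2 = 4 * (y + 1) + (b - 2) := by omega
    rw [e, codeC_four _ _ (by omega), codeD_four _ _ (by omega), codeC_four _ _ (by omega),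
      codeD_four _ _ (by omega)]
    omega
  · rw [add_assoc, codeC_four _ _ (by omega), codeD_four _ _ (by omega), codeC_four _ _ (by omega),
      codeD_four _ _ (by omega)]
    omega

theorem codeC_pow (j : ℕ) : codeC (2 ^ (j + 2)) = 2 * codeC (2 ^ j) := by
  have := codeC_four (2 ^ j) 0 (by omega)
  rw [show 2 ^ (j + 2) = 4 * 2 ^ j + 0 by ring, this]; simp

theorem codeD_pow (j : ℕ) : codeD (2 ^ (j + 2)) = 2 * codeD (2 ^ j) := by
  have := codeD_four (2 ^ j) 0 (by omega)
  rw [show 2 ^ (j + 2) = 4 * 2 ^ j + 0 by ring, this]; simp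

theorem codeC_1 : codeC 1 = 1 := by
  have := codeC_four 0 1 (by omega); simpa [codeC_zero] using this
theorem codeD_1 : codeD 1 = 0 := by
  have := codeD_four 0 1 (by omega); simpa [codeD_zero] using this
theorem codeC_2 : codeC 2 = 0 := by
  have := codeC_four 0 2 (by omega); simpa [codeC_zero] using this
theorem codeD_2 : codeD 2 = 1 := by
  have := codeD_four 0 2 (by omega); simpa [codeD_zero] using this

theorem add_pow_ple : ∀ (j x : ℕ), ple (codeC (x + 2 ^ j)) (codeD (x + 2 ^ j))
    (codeC x + codeC (2 ^ j)) (codeD x + codeD (2 ^ j))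
  | 0, x => by simpa [codeC_1, codeD_1] using add_one_ple x
  | 1, x => by simpa [codeC_2, codeD_2] using add_two_ple x
  | j + 2, x => by
    obtain ⟨y, b, hb, rfl⟩ : ∃ y b, b < 4 ∧ x = 4 * y + b :=
      ⟨x / 4, x % 4, by omega, by omega⟩
    have := add_pow_ple j y
    rw [codeC_pow, codeD_pow, show 4 * y + b + 2 ^ (j + 2) = 4 * (y + 2 ^ j) + b by ring,
      codeC_four _ _ hb, codeD_four _ _ hb, codeC_four _ _ hb, codeD_four _ _ hb]
    unfold ple at *
    omega

theorem add_pow_eq : ∀ (j x : ℕ), x < 2 ^ j → codeC (x + 2 ^ j) = codeC x + codeC (2 ^ j) ∧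
    codeD (x + 2 ^ j) = codeD x + codeD (2 ^ j)
  | 0, x, h => by
    have : x = 0 := by simpa using h
    subst this; simp [codeC_zero, codeD_zero]
  | 1, x, h => by
    have h0 := codeC_four 0 (x + 2) (by omega)
    have h1 := codeD_four 0 (x + 2) (by omega)
    have h2 := codeC_four 0 x (by omega)
    have h3 := codeD_four 0 x (by omega)
    simp only [mul_zero, zero_add, codeC_zero, codeD_zero] at h0 h1 h2 h3
    rw [pow_one, h0, h1, h2, h3, codeC_2, codeD_2]
    omega
  | j + 2, x, h => by
    obtain ⟨y, b, hb, rfl⟩ : ∃ y b, b < 4 ∧ x = 4 * y + b :=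
      ⟨x / 4, x % 4, by omega, by omega⟩
    have := add_pow_eq j y (by rw [pow_add] at h; omega)
    rw [codeC_pow, codeD_pow, show 4 * y + b + 2 ^ (j + 2) = 4 * (y + 2 ^ j) + b by ring,
      codeC_four _ _ hb, codeD_four _ _ hb, codeC_four _ _ hb, codeD_four _ _ hb]
    omega

theorem code_inj (x : ℕ) : ∀ y, codeC x = codeC y → codeD x = codeD y → x = y := by
  induction x using Nat.strong_induction_on with
  | _ x ih =>
    intro y h1 h2
    have a1 := codeC_step x
    have a2 := codeC_step y
    have a3 := codeD_step x
    have a4 := codeD_step y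
    by_cases hx : x = 0
    · subst hx
      clear a1 a2 a3 a4 ih
      induction y using Nat.strong_induction_on with
      | _ y ih =>
        have a2 := codeC_step y
        have a4 := codeD_step y
        rw [codeC_zero] at *
        rw [codeD_zero] at *
        by_contra hy
        have := ih (y / 4) (by omega) (by omega) (by omega)
        omega
    · have := ih (x / 4) (by omega) (y / 4) (by omega) (by omega)
      omega

theorem code_spec (g : ℕ → ℕ) (hg0 : g 0 = 0)
    (hge : ∀ n, g (2 * n) = 4 * g n)
    (hgo : ∀ n, g (2 * n + 1) = g (2 * n) + 1) (x : ℕ) :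
    x = g (codeC x) + 2 * g (codeD x) := by
  have key : ∀ b n, b < 2 → g (b + 2 * n) = b + 4 * g n := by
    intro b n hb
    interval_cases b
    · simp [hge]
    · rw [add_comm 1, hgo, hge]; ring
  induction x using Nat.strong_induction_on with
  | _ x ih =>
    by_cases hx : x = 0
    · subst hx; simp [codeC_zero, codeD_zero, hg0]
    · rw [codeC_step, codeD_step, key _ _ (by omega), key _ _ (by omega)]
      have := ih (x / 4) (by omega)
      omega

theorem code_unique (g : ℕ → ℕ) (hg0 : g 0 = 0)
    (hge : ∀ n, g (2 * n) = 4 * g n)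
    (hgo : ∀ n, g (2 * n + 1) = g (2 * n) + 1) (N : ℕ) :
    ∀ a b, a + b ≤ N → codeC (g a + 2 * g b) = a ∧ codeD (g a + 2 * g b) = b := by
  have key : ∀ n, g n = n % 2 + 4 * g (n / 2) := by
    intro n
    rcases Nat.even_or_odd' n with ⟨k, rfl | rfl⟩
    · rw [hge, show 2 * k / 2 = k by omega]; omega
    · rw [hgo, hge, show (2 * k + 1) / 2 = k by omega]; omega
  induction N with
  | zero =>
    intro a b h
    have ha : a = 0 := by omega
    have hb : b = 0 := by omega
    subst ha hb
    simp [hg0, codeC_zero, codeD_zero]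
  | succ N ih =>
    intro a b h
    by_cases h0 : a + b = 0
    · exact ih a b (by omega)
    · have := ih (a / 2) (b / 2) (by omega)
      have e : g a + 2 * g b = 4 * (g (a / 2) + 2 * g (b / 2)) + (a % 2 + 2 * (b % 2)) := by
        rw [key a, key b]; ring
      rw [e, codeC_four _ _ (by omega), codeD_four _ _ (by omega)]
      omega

theorem rec_pow (r : ℕ) (A : ℕ → Polynomial (ZMod 2))
    (hrec : ∀ n, Odd n → A (n + 8 * r) = X ^ (8 * r) * A n + X ^ (2 * r) * A (n + 2 * r))
    (k : ℕ) : ∀ n, Odd n → A (n + 8 * (r * 2 ^ k)) =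
      X ^ (8 * (r * 2 ^ k)) * A n + X ^ (2 * (r * 2 ^ k)) * A (n + 2 * (r * 2 ^ k)) := by
  induction k with
  | zero => simpa using hrec
  | succ k ih =>
    intro n hn
    rw [show r * 2 ^ (k + 1) = r * 2 ^ k * 2 by ring]
    generalize r * 2 ^ k = R at *
    have o1 : Odd (n + 8 * R) := by
      obtain ⟨t, rfl⟩ := hn; exact ⟨t + 4 * R, by ring⟩
    have o2 : Odd (n + 2 * R) := by
      obtain ⟨t, rfl⟩ := hn; exact ⟨t + R, by ring⟩
    have h1 := ih _ o1
    have h2 := ih _ o2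
    have h3 := ih _ hn
    rw [show n + 8 * R + 2 * R = n + 2 * R + 8 * R by ring, h2, h3] at h1
    rw [show n + 8 * (R * 2) = n + 8 * R + 8 * R by ring, h1,
      show n + 2 * (R * 2) = n + 2 * R + 2 * R by ring]
    have := CharTwo.add_self_eq_zero (X ^ (10 * R) * A (n + 2 * R) : Polynomial (ZMod 2))
    linear_combination this

theorem stmt_11 (g : ℕ → ℕ) (hg0 : g 0 = 0)
    (hge : ∀ n, g (2 * n) = 4 * g n)
    (hgo : ∀ n, g (2 * n + 1) = g (2 * n) + 1)
    (r : ℕ) (hr : ∃ e : ℕ, r = 2 ^ e)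
    (A : ℕ → Polynomial (ZMod 2))
    (hodd : ∀ n, Odd n → ∀ m, (A n).coeff m ≠ 0 → Odd m)
    (hrec : ∀ n, Odd n → A (n + 8 * r) = X ^ (8 * r) * A n + X ^ (2 * r) * A (n + 2 * r))
    (hinit : ∀ n, Odd n → n < 8 * r ^ 2 → ∀ a b, n = 1 + 2 * g a + 4 * g b →
      ∃ B : Polynomial (ZMod 2), A n = X ^ n + B ∧
        ∀ m, B.coeff m ≠ 0 → ∃ c d, m = 1 + 2 * g c + 4 * g d ∧ prec c d a b) :
    ∀ n, Odd n → 0 < n → ∀ a b, n = 1 + 2 * g a + 4 * g b →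
      ∃ B : Polynomial (ZMod 2), A n = X ^ n + B ∧
        ∀ m, B.coeff m ≠ 0 → ∃ c d, m = 1 + 2 * g c + 4 * g d ∧ prec c d a b := by
  have spec := code_spec g hg0 hge hgo
  have uniq : ∀ a b, codeC (g a + 2 * g b) = a ∧ codeD (g a + 2 * g b) = b :=
    fun a b => code_unique g hg0 hge hgo _ a b le_rfl
  have main : ∀ x, ∀ m, (A (2 * x + 1) - X ^ (2 * x + 1)).coeff m ≠ 0 →
      ∃ y, m = 2 * y + 1 ∧ prec (codeC y) (codeD y) (codeC x) (codeD x) := by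
    intro x
    induction x using Nat.strong_induction_on with
    | _ x ih =>
    obtain ⟨e, rfl⟩ := hr
    by_cases hx : x < 2 ^ (e + 2)
    · intro m hm
      have hlt : 2 * x + 1 < 8 * (2 ^ e) ^ 2 := by
        have : 2 ^ e ≤ (2 ^ e) ^ 2 := Nat.le_self_pow (by norm_num) _
        rw [pow_add] at hx
        omega
      obtain ⟨B, hB, hB2⟩ := hinit (2 * x + 1) ⟨x, rfl⟩ hlt (codeC x) (codeD x)
        (by have := spec x; omega)
      rw [hB, add_sub_cancel_left] at hm
      obtain ⟨c, d, h1, h2⟩ := hB2 m hm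
      refine ⟨g c + 2 * g d, by omega, ?_⟩
      rw [(uniq c d).1, (uniq c d).2]
      exact h2
    · obtain ⟨k, z, hz, rfl⟩ : ∃ k z, z < 2 ^ (e + k + 2) ∧ x = z + 2 ^ (e + k + 2) := by
        have hx0 : x ≠ 0 := by
          rintro rfl
          exact hx (by positivity)
        have h1 : 2 ^ Nat.log 2 x ≤ x := Nat.pow_log_le_self 2 hx0
        have h2 : x < 2 ^ (Nat.log 2 x + 1) := Nat.lt_pow_succ_log_self (by norm_num) x
        have h3 : e + 2 ≤ Nat.log 2 x := Nat.le_log_of_pow_le (by norm_num) (by omega)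
        refine ⟨Nat.log 2 x - (e + 2), x - 2 ^ Nat.log 2 x, ?_, ?_⟩
        · rw [show e + (Nat.log 2 x - (e + 2)) + 2 = Nat.log 2 x by omega]
          rw [pow_succ] at h2
          omega
        · rw [show e + (Nat.log 2 x - (e + 2)) + 2 = Nat.log 2 x by omega]
          omega
      have hR := rec_pow _ A hrec k (2 * z + 1) ⟨z, rfl⟩
      rw [← pow_add] at hR
      generalize e + k = s at *
      have hs : 2 ^ (s + 2) = 4 * 2 ^ s := by ring
      have hpos : 0 < 2 ^ s := by positivity
      have ih1 := ih z (by omega)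
      have ih2 := ih (z + 2 ^ s) (by omega)
      have q0 := add_pow_eq _ z hz
      have q1 := fun y => add_pow_ple (s + 2) y
      have q2 := fun y => add_pow_ple s y
      have cp := codeC_pow s
      have dp := codeD_pow s
      have hz' := hz
      intro m hm
      have hm2 : (X ^ (8 * 2 ^ s) * (A (2 * z + 1) - X ^ (2 * z + 1)) +
          X ^ (2 * 2 ^ s) * A (2 * (z + 2 ^ s) + 1)).coeff m ≠ 0 := by
        convert hm using 2
        rw [show 2 * (z + 2 ^ (s + 2)) + 1 = 2 * z + 1 + 8 * 2 ^ s by rw [hs]; ring, hR,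
          show 2 * (z + 2 ^ s) + 1 = 2 * z + 1 + 2 * 2 ^ s by ring]
        ring
      rw [coeff_add, coeff_X_pow_mul', coeff_X_pow_mul'] at hm2
      rw [q0.1, q0.2]
      by_cases c1 : 8 * 2 ^ s ≤ m ∧ (A (2 * z + 1) - X ^ (2 * z + 1)).coeff (m - 8 * 2 ^ s) ≠ 0
      · obtain ⟨y, hy, hp⟩ := ih1 _ c1.2
        refine ⟨y + 2 ^ (s + 2), by omega, ?_⟩
        have := q1 y
        unfold ple prec at *
        omega
      · have c2 : 2 * 2 ^ s ≤ m ∧ (A (2 * (z + 2 ^ s) + 1)).coeff (m - 2 * 2 ^ s) ≠ 0 := by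
          by_contra hc
          apply hm2
          have t1 : (if 8 * 2 ^ s ≤ m then
            (A (2 * z + 1) - X ^ (2 * z + 1)).coeff (m - 8 * 2 ^ s) else 0) = 0 := by
            split_ifs with h
            · by_contra h'; exact c1 ⟨h, h'⟩
            · rfl
          have t2 : (if 2 * 2 ^ s ≤ m then
            (A (2 * (z + 2 ^ s) + 1)).coeff (m - 2 * 2 ^ s) else 0) = 0 := by
            split_ifs with h
            · by_contra h'; exact hc ⟨h, h'⟩
            · rfl
          rw [t1, t2, add_zero]
        obtain ⟨hle, hc⟩ := c2
        have r1 := q2 z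
        by_cases hlead : m - 2 * 2 ^ s = 2 * (z + 2 ^ s) + 1
        · refine ⟨z + 2 ^ s + 2 ^ s, by omega, ?_⟩
          have r2 := q2 (z + 2 ^ s)
          have ne : ¬ (codeC (z + 2 ^ s + 2 ^ s) = codeC (z + 2 ^ (s + 2)) ∧
              codeD (z + 2 ^ s + 2 ^ s) = codeD (z + 2 ^ (s + 2))) := by
            rintro ⟨h1, h2⟩
            have := code_inj _ _ h1 h2
            omega
          rw [q0.1, q0.2] at ne
          unfold ple prec at *
          omega
        · have hc' : (A (2 * (z + 2 ^ s) + 1) - X ^ (2 * (z + 2 ^ s) + 1)).coeff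
              (m - 2 * 2 ^ s) ≠ 0 := by
            rw [coeff_sub, coeff_X_pow, if_neg hlead, sub_zero]
            exact hc
          obtain ⟨y, hy, hp⟩ := ih2 _ hc'
          refine ⟨y + 2 ^ s, by omega, ?_⟩
          have r2 := q2 y
          unfold ple prec at *
          omega
  intro n hn _ a b hab
  refine ⟨A n - X ^ n, by ring, ?_⟩
  intro m hm
  have hx : n = 2 * (g a + 2 * g b) + 1 := by omega
  rw [hx] at hm
  obtain ⟨y, hy, hp⟩ := main _ m hm
  rw [(uniq a b).1, (uniq a b).2] at hp
  exact ⟨codeC y, codeD y, by have := spec y; omega, hp⟩
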